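/- arXiv:2304.08172 — 5 statements merged into one kernel-verified Lean document; each statement's English description precedes it below -/
import Mathlib

section
/- Let g : [0,1] → [0,1] be the tent map, g(x) = 2x for 0 ≤ x ≤ 1/2 and g(x) = 2(1−x) for 1/2 ≤ x ≤ 1, and let g^{∘s} denote its s-fold composition. For m ≥ 1 define f_m(x) = x − Σ_{s=1}^{m} g^{∘s}(x)/4^s. Then sup_{x ∈ [0,1]} |f_m(x) − x²| ≤ 4^{−(m+1)}. -/
/-- A map that sends `[0,1]` to itself and satisfies the functional equation of the tent map
yields a telescoping expansion of `x - x ^ 2`. -/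
lemma sub_sq_eq_sum_iterate_add {g : ℝ → ℝ} (hmaps : Set.MapsTo g (Set.Icc 0 1) (Set.Icc 0 1))
    (hg : ∀ x ∈ Set.Icc (0 : ℝ) 1, x - x ^ 2 = (g x + (g x - g x ^ 2)) / 4)
    (m : ℕ) {x : ℝ} (hx : x ∈ Set.Icc (0 : ℝ) 1) :
    x - x ^ 2 = ∑ s ∈ Finset.Icc 1 m, g^[s] x / 4 ^ s + (g^[m] x - (g^[m] x) ^ 2) / 4 ^ m := by
  induction m with
  | zero => simp
  | succ k ih =>
    rw [Finset.sum_Icc_succ_top (by omega), ih, hg _ (hmaps.iterate k hx),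
      Function.iterate_succ_apply']
    field_simp
    ring

/-- Let `g` be the tent map on `[0,1]` and `f_m x = x - ∑_{s=1}^m g^[s] x / 4^s`.
Then `sup_{x ∈ [0,1]} |f_m x - x^2| ≤ 4^{-(m+1)}`. -/
theorem tent_map_approx_sq (g : ℝ → ℝ)
    (hg₁ : ∀ x : ℝ, 0 ≤ x → x ≤ 1 / 2 → g x = 2 * x)
    (hg₂ : ∀ x : ℝ, 1 / 2 ≤ x → x ≤ 1 → g x = 2 * (1 - x))
    (m : ℕ) (hm : 1 ≤ m) :
    ∀ x ∈ Set.Icc (0 : ℝ) 1,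
      |(x - ∑ s ∈ Finset.Icc 1 m, g^[s] x / 4 ^ s) - x ^ 2| ≤ (4 : ℝ) ^ (-(m + 1 : ℤ)) := by
  intro x hx
  have hmaps : Set.MapsTo g (Set.Icc 0 1) (Set.Icc 0 1) := by
    rintro y ⟨hy₀, hy₁⟩
    rcases le_total y (1 / 2) with h | h
    · rw [hg₁ y hy₀ h]
      constructor <;> linarith
    · rw [hg₂ y h hy₁]
      constructor <;> linarith
  have hg : ∀ y ∈ Set.Icc (0 : ℝ) 1, y - y ^ 2 = (g y + (g y - g y ^ 2)) / 4 := by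
    rintro y ⟨hy₀, hy₁⟩
    rcases le_total y (1 / 2) with h | h
    · rw [hg₁ y hy₀ h]
      ring
    · rw [hg₂ y h hy₁]
      ring
  obtain ⟨h₀, h₁⟩ := hmaps.iterate m hx
  have herr : (x - ∑ s ∈ Finset.Icc 1 m, g^[s] x / 4 ^ s) - x ^ 2 =
      (g^[m] x - (g^[m] x) ^ 2) / 4 ^ m := by
    linarith [sub_sq_eq_sum_iterate_add hmaps hg m hx]
  have hpow : (4 : ℝ) ^ (-(m + 1 : ℤ)) = 1 / 4 / 4 ^ m := by
    rw [zpow_neg, zpow_add_one₀ (by norm_num), zpow_natCast]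
    field_simp
  rw [herr, hpow, abs_of_nonneg (div_nonneg (by nlinarith) (by positivity))]
  gcongr
  nlinarith [sq_nonneg (g^[m] x - 1 / 2)]
end

section
/- Let h(x) = max(x,0), let n ∈ ℕ, d ≥ 1, and fix x ∈ ℝ^d, weights w_j ∈ ℝ^d and biases b_j ∈ ℝ for j = 1,…,2^n. Define the first layer z¹_j = h(w_j·x + b_j) for j = 1,…,2^n, and recursively for k = 1,…,n and J = 1,…,2^{n−k}: z^{2k}_{3J−2} = h(½ z^{2k−1}_{2J−1} + ½ z^{2k−1}_{2J}), z^{2k}_{3J−1} = h(½ z^{2k−1}_{2J−1} − ½ z^{2k−1}_{2J}), z^{2k}_{3J} = h(−½ z^{2k−1}_{2J−1} + ½ z^{2k−1}_{2J}), and z^{2k+1}_J = z^{2k}_{3J−2} − z^{2k}_{3J−1} − z^{2k}_{3J}. Then z^{2n+1}_1 = min_{1 ≤ j ≤ 2^n} h(w_j·x + b_j); consequently the network output f_N(x) := min{z^{2n+1}_1, 1} equals min{1, min_{1 ≤ j ≤ 2^n} h(w_j·x + b_j)}. -/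
open scoped RealInnerProductSpace

/-- One flipping layer followed by its cancellation layer computes the minimum of two
nonnegative reals. -/
lemma flip_cancel_eq_min {u v : ℝ} (hu : 0 ≤ u) (hv : 0 ≤ v) :
    max ((1 / 2) * u + (1 / 2) * v) 0 - max ((1 / 2) * u - (1 / 2) * v) 0
      - max (-(1 / 2) * u + (1 / 2) * v) 0 = min u v := by
  rw [max_eq_left (by positivity : (0 : ℝ) ≤ (1 / 2) * u + (1 / 2) * v)]
  rcases le_total u v with h | h
  · rw [min_eq_left h, max_eq_right (by linarith), max_eq_left (by linarith)]
    ring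
  · rw [min_eq_right h, max_eq_left (by linarith), max_eq_right (by linarith)]
    ring

/-- If each entry of level `k + 1` is the minimum of two consecutive entries of level `k` whenever
these are nonnegative, then the entry `J` of level `k` is the greatest lower bound of the `J`-th
block of `2 ^ k` entries of level `0`. -/
lemma le_pairwise_min_iff {n : ℕ} {f : ℕ → ℝ} {m : ℕ → ℕ → ℝ} (hf : ∀ j, 0 ≤ f j)
    (h0 : ∀ j, 1 ≤ j → j ≤ 2 ^ n → m 0 j = f j)
    (hstep : ∀ k J, k + 1 ≤ n → 1 ≤ J → J ≤ 2 ^ (n - (k + 1)) →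
      0 ≤ m k (2 * J - 1) → 0 ≤ m k (2 * J) →
      m (k + 1) J = min (m k (2 * J - 1)) (m k (2 * J)))
    (k J : ℕ) (hk : k ≤ n) (hJ : 1 ≤ J) (hJn : J ≤ 2 ^ (n - k)) (c : ℝ) :
    c ≤ m k J ↔ ∀ j, (J - 1) * 2 ^ k < j → j ≤ J * 2 ^ k → c ≤ f j := by
  induction k generalizing J c with
  | zero =>
    rw [h0 J hJ hJn]
    refine ⟨fun h j hj hj' => ?_, fun h => h J (by omega) (by omega)⟩
    obtain rfl : j = J := by omega
    exact h
  | succ k ih =>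
    have hpow : 2 ^ (n - k) = 2 * 2 ^ (n - (k + 1)) := by
      rw [← pow_succ']
      congr 1
      omega
    have hodd := ih (2 * J - 1) (by omega) (by omega) (by omega)
    have heven := ih (2 * J) (by omega) (by omega) (by omega)
    rw [hstep k J hk hJ hJn ((hodd 0).2 fun j _ _ => hf j) ((heven 0).2 fun j _ _ => hf j),
      le_min_iff, hodd, heven]
    obtain ⟨i, rfl⟩ : ∃ i, J = i + 1 := ⟨J - 1, by omega⟩
    have e₁ : 2 * (i + 1) - 1 - 1 = 2 * i := by omega
    have e₂ : 2 * (i + 1) - 1 = 2 * i + 1 := by omega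
    rw [e₁, e₂, Nat.add_sub_cancel]
    have e₃ : i * 2 ^ (k + 1) = 2 * i * 2 ^ k := by ring
    have e₄ : (i + 1) * 2 ^ (k + 1) = 2 * (i + 1) * 2 ^ k := by ring
    have h₁ : 2 * i * 2 ^ k ≤ (2 * i + 1) * 2 ^ k := Nat.mul_le_mul_right _ (by omega)
    have h₂ : (2 * i + 1) * 2 ^ k ≤ 2 * (i + 1) * 2 ^ k := Nat.mul_le_mul_right _ (by omega)
    rw [e₃, e₄]
    constructor
    · rintro ⟨hl, hr⟩ j hj hj'
      rcases le_or_gt j ((2 * i + 1) * 2 ^ k) with h | h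
      · exact hl j hj h
      · exact hr j h hj'
    · exact fun h => ⟨fun j hj hj' => h j hj (hj'.trans h₂),
        fun j hj hj' => h j (h₁.trans_lt hj) hj'⟩

/-- The sparse deep network of depth `2n+1` built from "flipping" ReLU layers and
"cancellation" linear layers computes `z^{2n+1}_1 = min_{1 ≤ j ≤ 2^n} h(w_j·x + b_j)`,
and its clipped output equals `min{1, min_j h(w_j·x + b_j)}`. -/
theorem deep_network_computes_min (n d : ℕ) (hd : 1 ≤ d)
    (x : EuclideanSpace ℝ (Fin d))
    (w : ℕ → EuclideanSpace ℝ (Fin d)) (b : ℕ → ℝ)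
    (z : ℕ → ℕ → ℝ)
    (hz1 : ∀ j, 1 ≤ j → j ≤ 2 ^ n → z 1 j = max (⟪w j, x⟫ + b j) 0)
    (hflip : ∀ k J, 1 ≤ k → k ≤ n → 1 ≤ J → J ≤ 2 ^ (n - k) →
      z (2 * k) (3 * J - 2)
          = max ((1 / 2) * z (2 * k - 1) (2 * J - 1) + (1 / 2) * z (2 * k - 1) (2 * J)) 0 ∧
      z (2 * k) (3 * J - 1)
          = max ((1 / 2) * z (2 * k - 1) (2 * J - 1) - (1 / 2) * z (2 * k - 1) (2 * J)) 0 ∧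
      z (2 * k) (3 * J)
          = max (-(1 / 2) * z (2 * k - 1) (2 * J - 1) + (1 / 2) * z (2 * k - 1) (2 * J)) 0)
    (hcancel : ∀ k J, 1 ≤ k → k ≤ n → 1 ≤ J → J ≤ 2 ^ (n - k) →
      z (2 * k + 1) J = z (2 * k) (3 * J - 2) - z (2 * k) (3 * J - 1) - z (2 * k) (3 * J)) :
    z (2 * n + 1) 1
        = (Finset.Icc 1 (2 ^ n)).inf' (Finset.nonempty_Icc.mpr Nat.one_le_two_pow)
            (fun j => max (⟪w j, x⟫ + b j) 0) ∧
    min (z (2 * n + 1) 1) 1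
        = min 1 ((Finset.Icc 1 (2 ^ n)).inf' (Finset.nonempty_Icc.mpr Nat.one_le_two_pow)
            (fun j => max (⟪w j, x⟫ + b j) 0)) := by
  have key := le_pairwise_min_iff (n := n) (f := fun j => max (⟪w j, x⟫ + b j) 0)
    (m := fun k => z (2 * k + 1)) (fun j => le_max_right _ _) hz1
    (fun k J hk hJ hJn hu hv => by
      obtain ⟨h₁, h₂, h₃⟩ := hflip (k + 1) J (by omega) hk hJ hJn
      have e : 2 * (k + 1) - 1 = 2 * k + 1 := by omega
      rw [e] at h₁ h₂ h₃
      rw [hcancel (k + 1) J (by omega) hk hJ hJn, h₁, h₂, h₃]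
      exact flip_cancel_eq_min hu hv)
    n 1 le_rfl le_rfl Nat.one_le_two_pow
  have hmin : z (2 * n + 1) 1
      = (Finset.Icc 1 (2 ^ n)).inf' (Finset.nonempty_Icc.mpr Nat.one_le_two_pow)
          (fun j => max (⟪w j, x⟫ + b j) 0) := by
    refine eq_of_forall_le_iff fun c => ?_
    rw [key c, Finset.le_inf'_iff]
    simp only [Nat.sub_self, zero_mul, one_mul, Finset.mem_Icc, and_imp, Nat.succ_le_iff]
  exact ⟨hmin, by rw [min_comm, hmin]⟩
end

section
/- Let h(x) = max(x,0), N ≥ 1, let τ_1,…,τ_N ∈ ℝ^d be unit vectors, and for each j let (a_j^{(t)})_{t ∈ ℕ} be a sequence of positive reals with a_j^{(t)} → ∞ as t → ∞. Define f_t(x) = min{1, min_{1 ≤ j ≤ N} h(a_j^{(t)}(τ_j·x + 1/2) + 1)} and let χ be the indicator function of the set ⋂_{j=1}^N {x ∈ ℝ^d : τ_j·x ≥ −1/2}. Then for every x ∈ ℝ^d, f_t(x) → χ(x) as t → ∞. -/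
open scoped RealInnerProductSpace Classical

/-- With unit directions `τ_j` and magnitudes `a_j^{(t)} → ∞`, the network functions
`f_t(x) = min{1, min_j h(a_j^{(t)}(τ_j·x + 1/2) + 1)}` converge pointwise, as `t → ∞`,
to the indicator of `⋂_j {x : τ_j·x ≥ -1/2}`. -/
theorem network_tendsto_indicator (d N : ℕ) (hN : 1 ≤ N)
    (τ : ℕ → EuclideanSpace ℝ (Fin d)) (hτ : ∀ j ∈ Finset.Icc 1 N, ‖τ j‖ = 1)
    (a : ℕ → ℕ → ℝ) (ha_pos : ∀ j ∈ Finset.Icc 1 N, ∀ t : ℕ, 0 < a j t)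
    (ha_top : ∀ j ∈ Finset.Icc 1 N, Filter.Tendsto (fun t => a j t) Filter.atTop Filter.atTop)
    (f : ℕ → EuclideanSpace ℝ (Fin d) → ℝ)
    (hf : ∀ t x, f t x = min 1 ((Finset.Icc 1 N).inf' (Finset.nonempty_Icc.mpr hN)
      fun j => max (a j t * (⟪τ j, x⟫ + 1 / 2) + 1) 0))
    (χ : EuclideanSpace ℝ (Fin d) → ℝ)
    (hχ : ∀ x, χ x = if ∀ j ∈ Finset.Icc 1 N, -(1 / 2) ≤ ⟪τ j, x⟫ then 1 else 0) :
    ∀ x : EuclideanSpace ℝ (Fin d),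
      Filter.Tendsto (fun t => f t x) Filter.atTop (nhds (χ x)) := by
  intro x
  refine tendsto_const_nhds.congr' ?_
  rw [hχ]
  split_ifs with hx
  · filter_upwards with t
    rw [hf, eq_comm, min_eq_left_iff, Finset.le_inf'_iff]
    intro j hj
    have h_nonneg : 0 ≤ a j t * (⟪τ j, x⟫ + 1 / 2) :=
      mul_nonneg (ha_pos j hj t).le (by linarith [hx j hj])
    exact le_max_of_le_left (by linarith)
  · push Not at hx
    obtain ⟨j, hj, hlt⟩ := hx
    have h_bot : Filter.Tendsto (fun t => a j t * (⟪τ j, x⟫ + 1 / 2)) Filter.atTop Filter.atBot :=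
      (ha_top j hj).atTop_mul_const_of_neg (by linarith)
    filter_upwards [h_bot.eventually_le_atBot (-1)] with t ht
    rw [hf]
    refine le_antisymm (le_min zero_le_one ?_) (min_le_of_right_le ?_)
    · exact Finset.le_inf' _ _ fun i _ => le_max_right _ _
    · exact (Finset.inf'_le _ hj).trans (max_le (by linarith) le_rfl)
end

section
/- Let c > 0 and let (a_t)_{t ∈ ℕ} be a sequence of real numbers with a_0 > 0 and a_{t+1} ≥ a_t + c / a_t² for every t. Then a_t > 0 for all t and a_t ≥ (a_0³ + 3 c t)^{1/3} for every t ∈ ℕ. -/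
/-- One step of the recursion increases the cube by at least `3 c`. -/
theorem cube_add_le_cube_of_add_div_sq_le {c x y : ℝ} (hc : 0 ≤ c) (hx : 0 < x)
    (h : x + c / x ^ 2 ≤ y) : x ^ 3 + 3 * c ≤ y ^ 3 := by
  have hd : 0 ≤ c / x ^ 2 := by positivity
  calc x ^ 3 + 3 * c = x ^ 3 + 3 * x ^ 2 * (c / x ^ 2) := by field_simp
    _ ≤ x ^ 3 + 3 * x ^ 2 * (c / x ^ 2) + (3 * x * (c / x ^ 2) ^ 2 + (c / x ^ 2) ^ 3) :=
      le_add_of_nonneg_right (by positivity)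
    _ = (x + c / x ^ 2) ^ 3 := by ring
    _ ≤ y ^ 3 := by gcongr

/-- Discrete comparison principle: if `a 0 > 0` and `a (t+1) ≥ a t + c / (a t)^2` with `c > 0`,
then `a t > 0` for all `t` and `a t ≥ (a 0 ^ 3 + 3 c t)^{1/3}`. -/
theorem discrete_comparison (c : ℝ) (hc : 0 < c) (a : ℕ → ℝ) (ha0 : 0 < a 0)
    (hrec : ∀ t : ℕ, a (t + 1) ≥ a t + c / (a t) ^ 2) :
    (∀ t : ℕ, 0 < a t) ∧
      ∀ t : ℕ, a t ≥ (a 0 ^ 3 + 3 * c * t) ^ ((1 : ℝ) / 3) := by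
  have hpos : ∀ t : ℕ, 0 < a t := by
    intro t
    induction t with
    | zero => exact ha0
    | succ t ih => exact lt_of_lt_of_le (by positivity) (hrec t)
  have hcube : ∀ t : ℕ, a 0 ^ 3 + 3 * c * t ≤ a t ^ 3 := by
    intro t
    induction t with
    | zero => simp
    | succ t ih =>
      have hstep := cube_add_le_cube_of_add_div_sq_le hc.le (hpos t) (hrec t)
      push_cast
      linarith
  refine ⟨hpos, fun t => ?_⟩
  calc (a 0 ^ 3 + 3 * c * t) ^ ((1 : ℝ) / 3) ≤ (a t ^ 3) ^ ((1 : ℝ) / 3) :=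
        Real.rpow_le_rpow (by positivity) (hcube t) (by norm_num)
    _ = a t := by
      rw [one_div]
      exact_mod_cast Real.pow_rpow_inv_natCast (hpos t).le three_ne_zero
end

section
/- Let h(x) = max(x,0), let τ_1,…,τ_N ∈ ℝ^d be unit vectors, let r ≥ 1 be real, and let c, κ > 0. Suppose for each j = 1,…,N and each t ∈ ℕ we have a_j(t) > 0 with a_j(t) ≥ (c³ + 3κ t)^{1/3}. Define f_t(x) = min{1, min_{1 ≤ j ≤ N} h(a_j(t)(τ_j·x + 1/2) + 1)} and let χ be the indicator function of ⋂_{j=1}^{N} {x ∈ ℝ^d : τ_j·x ≥ −1/2}. Then for every t ∈ ℕ, ∫_{[−1,1]^d} |f_t(x) − χ(x)|^r dx ≤ √d · 2^{d−1} · N · (c³ + 3κ t)^{−1/3}; in particular ‖f_t − χ‖_{L^r([−1,1]^d)}^r ≲ t^{−1/3}. -/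
open MeasureTheory
open scoped RealInnerProductSpace Classical

/-- An affine strip of width `ε` on the line with slope `u` has length at most `ε / |u|`. -/
theorem volume_affine_strip_le {u : ℝ} (hu : u ≠ 0) (b ε k : ℝ) :
    volume {s : ℝ | b - ε ≤ u * s + k ∧ u * s + k ≤ b} ≤ ENNReal.ofReal (ε / |u|) := by
  have hsub : {s : ℝ | b - ε ≤ u * s + k ∧ u * s + k ≤ b} ⊆
      Metric.closedBall ((b - ε / 2 - k) / u) (ε / |u| / 2) := by
    rintro s ⟨h₁, h₂⟩
    have hs : s - (b - ε / 2 - k) / u = (u * s + k - (b - ε / 2)) / u := by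
      field_simp
      ring
    rw [Metric.mem_closedBall, Real.dist_eq, hs, abs_div, div_right_comm]
    gcongr
    rw [abs_le]
    constructor <;> linarith
  refine (measure_mono hsub).trans ?_
  rw [Real.volume_closedBall, mul_div_cancel₀ _ two_ne_zero]

/-- The part of a strip `{b - ε ≤ u ⬝ x ≤ b}` inside the cube `[-1,1]^(n+1)` has volume at most
`2^n ε / |u i|`, for every coordinate `i` with `u i ≠ 0`. -/
theorem volume_cube_inter_strip_le {n : ℕ} (u : Fin (n + 1) → ℝ) (i : Fin (n + 1))
    (hu : u i ≠ 0) (b ε : ℝ) :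
    volume {x : Fin (n + 1) → ℝ | (∀ k, x k ∈ Set.Icc (-1 : ℝ) 1) ∧
      b - ε ≤ ∑ k, u k * x k ∧ ∑ k, u k * x k ≤ b} ≤
      ENNReal.ofReal (2 ^ n * (ε / |u i|)) := by
  let P : Set (ℝ × (Fin n → ℝ)) := {p | p.2 ∈ Set.Icc (fun _ => (-1 : ℝ)) (fun _ => 1) ∧
    b - ε ≤ u i * p.1 + ∑ k, u (i.succAbove k) * p.2 k ∧
    u i * p.1 + ∑ k, u (i.succAbove k) * p.2 k ≤ b}
  have hcont : Continuous fun p : ℝ × (Fin n → ℝ) =>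
      u i * p.1 + ∑ k, u (i.succAbove k) * p.2 k := by fun_prop
  have hPc : IsClosed P := (isClosed_Icc.preimage continuous_snd).inter
    ((isClosed_le continuous_const hcont).inter (isClosed_le hcont continuous_const))
  have hP : MeasurableSet P := hPc.measurableSet
  have hpre : {x : Fin (n + 1) → ℝ | (∀ k, x k ∈ Set.Icc (-1 : ℝ) 1) ∧
      b - ε ≤ ∑ k, u k * x k ∧ ∑ k, u k * x k ≤ b} ⊆
      MeasurableEquiv.piFinSuccAbove (fun _ => ℝ) i ⁻¹' P := by
    rintro x ⟨hx, h⟩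
    rw [Fin.sum_univ_succAbove _ i] at h
    exact ⟨⟨fun k => (hx _).1, fun k => (hx _).2⟩, h⟩
  refine (measure_mono hpre).trans ?_
  rw [(volume_preserving_piFinSuccAbove (fun _ => ℝ) i).measure_preimage hP.nullMeasurableSet,
    Measure.volume_eq_prod, Measure.prod_apply_symm hP]
  calc ∫⁻ y, volume ((fun s : ℝ => (s, y)) ⁻¹' P)
      ≤ ∫⁻ y, (Set.Icc (fun _ : Fin n => (-1 : ℝ)) (fun _ => 1)).indicator
          (fun _ => ENNReal.ofReal (ε / |u i|)) y := by
        refine lintegral_mono fun y => ?_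
        by_cases hy : y ∈ Set.Icc (fun _ : Fin n => (-1 : ℝ)) (fun _ => 1)
        · rw [Set.indicator_of_mem hy]
          exact (measure_mono fun s hs => hs.2).trans
            (volume_affine_strip_le hu b ε (∑ k, u (i.succAbove k) * y k))
        · rw [Set.indicator_of_notMem hy, nonpos_iff_eq_zero]
          convert measure_empty (μ := (volume : Measure ℝ))
          exact Set.eq_empty_of_forall_notMem fun s hs => hy hs.1
    _ = ENNReal.ofReal (2 ^ n * (ε / |u i|)) := by
        rw [lintegral_indicator_const measurableSet_Icc, Real.volume_Icc_pi,
          ENNReal.ofReal_mul (by positivity), mul_comm, ENNReal.ofReal_pow zero_le_two]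
        norm_num

/-- A unit vector of `ℝ^d` has a coordinate of size at least `1 / √d`. -/
theorem exists_one_le_sqrt_mul_abs_coord {d : ℕ} {v : EuclideanSpace ℝ (Fin d)}
    (hv : ‖v‖ = 1) : ∃ i, 1 ≤ Real.sqrt d * |v i| := by
  by_contra! h
  have hsum : ∑ i, v i ^ 2 = 1 := by
    rw [← EuclideanSpace.real_norm_sq_eq, hv, one_pow]
  have hne : (Finset.univ : Finset (Fin d)).Nonempty := by
    by_contra hne
    rw [Finset.not_nonempty_iff_eq_empty.mp hne, Finset.sum_empty] at hsum
    exact zero_ne_one hsum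
  have hlt : ∑ i, (d : ℝ) * v i ^ 2 < ∑ _i : Fin d, (1 : ℝ) := by
    refine Finset.sum_lt_sum_of_nonempty hne fun i _ => ?_
    have hsq : (d : ℝ) * v i ^ 2 = (Real.sqrt d * |v i|) ^ 2 := by
      rw [mul_pow, Real.sq_sqrt d.cast_nonneg, sq_abs]
    rw [hsq]
    exact pow_lt_one₀ (by positivity) (h i) two_ne_zero
  rw [← Finset.mul_sum, hsum] at hlt
  simp at hlt

/-- The part of a strip of width `ε`, orthogonal to a unit vector, inside the cube `[-1,1]^d`
has volume at most `√d 2^(d-1) ε`. -/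
theorem volume_cube_inter_unit_strip_le {d : ℕ} {v : EuclideanSpace ℝ (Fin d)}
    (hv : ‖v‖ = 1) (b : ℝ) {ε : ℝ} (hε : 0 ≤ ε) :
    volume {x : EuclideanSpace ℝ (Fin d) | (∀ k, x k ∈ Set.Icc (-1 : ℝ) 1) ∧
      b - ε ≤ ⟪v, x⟫ ∧ ⟪v, x⟫ ≤ b} ≤ ENNReal.ofReal (Real.sqrt d * 2 ^ (d - 1) * ε) := by
  obtain ⟨i, hi⟩ := exists_one_le_sqrt_mul_abs_coord hv
  obtain _ | n := d
  · exact i.elim0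
  have hvi : v i ≠ 0 := by
    intro h
    norm_num [h] at hi
  have hset : {x : EuclideanSpace ℝ (Fin (n + 1)) | (∀ k, x k ∈ Set.Icc (-1 : ℝ) 1) ∧
      b - ε ≤ ⟪v, x⟫ ∧ ⟪v, x⟫ ≤ b} = (MeasurableEquiv.toLp 2 (Fin (n + 1) → ℝ)).symm ⁻¹'
      {x | (∀ k, x k ∈ Set.Icc (-1 : ℝ) 1) ∧
        b - ε ≤ ∑ k, v k * x k ∧ ∑ k, v k * x k ≤ b} := by
    ext x
    simp [PiLp.inner_apply, mul_comm]
  rw [hset, (EuclideanSpace.volume_preserving_symm_measurableEquiv_toLp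
    (Fin (n + 1))).measure_preimage_equiv]
  refine (volume_cube_inter_strip_le (fun k => v k) i hvi b ε).trans
    (ENNReal.ofReal_le_ofReal ?_)
  have hdiv : ε / |v i| ≤ Real.sqrt (n + 1 : ℕ) * ε := by
    rw [div_le_iff₀ (abs_pos.mpr hvi)]
    nlinarith
  calc 2 ^ n * (ε / |v i|) ≤ 2 ^ n * (Real.sqrt (n + 1 : ℕ) * ε) := by gcongr
    _ = Real.sqrt (n + 1 : ℕ) * 2 ^ (n + 1 - 1) * ε := by
        rw [Nat.add_sub_cancel]
        ring

/-- The cube `[-1,1]^d` intersected with a strip is measurable. -/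
theorem measurableSet_cube_inter_strip {d : ℕ} (v : EuclideanSpace ℝ (Fin d)) (b b' : ℝ) :
    MeasurableSet {x : EuclideanSpace ℝ (Fin d) | (∀ k, x k ∈ Set.Icc (-1 : ℝ) 1) ∧
      b' ≤ ⟪v, x⟫ ∧ ⟪v, x⟫ ≤ b} := by
  have hcube : IsClosed {x : EuclideanSpace ℝ (Fin d) | ∀ k, x k ∈ Set.Icc (-1 : ℝ) 1} := by
    simp only [Set.ofPred_forall]
    exact isClosed_iInter fun k => isClosed_Icc.preimage (by fun_prop)
  have hcont : Continuous fun x : EuclideanSpace ℝ (Fin d) => ⟪v, x⟫ := by fun_prop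
  exact (hcube.inter ((isClosed_le continuous_const hcont).inter
    (isClosed_le hcont continuous_const))).measurableSet

/-- A clipped minimum of ReLU units with slopes at least `A` equals the indicator of
`s j ≥ -1/2` for all `j`, unless some `s j` lies within `1 / A` below `-1/2`. -/
theorem relu_min_eq_indicator {ι : Type*} {J : Finset ι} (hJ : J.Nonempty)
    {α s : ι → ℝ} {A : ℝ} (hA : 0 < A) (hα : ∀ j ∈ J, A ≤ α j)
    (hs : ∀ j ∈ J, ¬(-(1 / 2) - 1 / A ≤ s j ∧ s j ≤ -(1 / 2))) :
    min 1 (J.inf' hJ fun j => max (α j * (s j + 1 / 2) + 1) 0) =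
      if ∀ j ∈ J, -(1 / 2) ≤ s j then 1 else 0 := by
  split_ifs with h
  · refine min_eq_left (Finset.le_inf' _ _ fun j hj => le_max_of_le_left ?_)
    have := mul_nonneg (hA.le.trans (hα j hj)) (by linarith [h j hj] : 0 ≤ s j + 1 / 2)
    linarith
  · push Not at h
    obtain ⟨j, hj, hlt⟩ := h
    have hlow : s j < -(1 / 2) - 1 / A := by
      by_contra! hle
      exact hs j hj ⟨hle, hlt.le⟩
    have hneg : α j * (s j + 1 / 2) + 1 ≤ 0 := by
      have h₁ : A * (s j + 1 / 2) ≤ A * (-(1 / A)) := by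
        gcongr
        linarith
      have h₂ : A * (-(1 / A)) = -1 := by field_simp
      have h₃ := mul_le_mul_of_nonpos_right (hα j hj) (by linarith : s j + 1 / 2 ≤ 0)
      linarith
    have hle : (J.inf' hJ fun j => max (α j * (s j + 1 / 2) + 1) 0) ≤ 0 :=
      (Finset.inf'_le _ hj).trans_eq (max_eq_right hneg)
    have hge : 0 ≤ (J.inf' hJ fun j => max (α j * (s j + 1 / 2) + 1) 0) :=
      Finset.le_inf' _ _ fun j _ => le_max_right _ _
    rw [le_antisymm hle hge, min_eq_right zero_le_one]

/-- With weight magnitudes growing like `a_j(t) ≥ (c³ + 3κt)^{1/3}`, the network functions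
`f_t` converge to the limit indicator `χ` in `L^r([-1,1]^d)` at rate
`‖f_t - χ‖_{L^r}^r ≤ √d · 2^{d-1} · N · (c³ + 3κt)^{-1/3} ≲ t^{-1/3}`. -/
theorem network_Lr_rate (d N : ℕ) (hN : 1 ≤ N)
    (τ : ℕ → EuclideanSpace ℝ (Fin d)) (hτ : ∀ j ∈ Finset.Icc 1 N, ‖τ j‖ = 1)
    (r : ℝ) (hr : 1 ≤ r) (c κ : ℝ) (hc : 0 < c) (hκ : 0 < κ)
    (a : ℕ → ℕ → ℝ) (ha_pos : ∀ j ∈ Finset.Icc 1 N, ∀ t : ℕ, 0 < a j t)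
    (ha_growth : ∀ j ∈ Finset.Icc 1 N, ∀ t : ℕ,
      (c ^ 3 + 3 * κ * t) ^ ((1 : ℝ) / 3) ≤ a j t)
    (f : ℕ → EuclideanSpace ℝ (Fin d) → ℝ)
    (hf : ∀ t x, f t x = min 1 ((Finset.Icc 1 N).inf' (Finset.nonempty_Icc.mpr hN)
      fun j => max (a j t * (⟪τ j, x⟫ + 1 / 2) + 1) 0))
    (χ : EuclideanSpace ℝ (Fin d) → ℝ)
    (hχ : ∀ x, χ x = if ∀ j ∈ Finset.Icc 1 N, -(1 / 2) ≤ ⟪τ j, x⟫ then 1 else 0) :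
    (∀ t : ℕ,
      ∫ x in {x : EuclideanSpace ℝ (Fin d) | ∀ i, x i ∈ Set.Icc (-1 : ℝ) 1},
          |f t x - χ x| ^ r ≤
        Real.sqrt d * 2 ^ (d - 1) * N * (c ^ 3 + 3 * κ * t) ^ (-(1 : ℝ) / 3)) ∧
    ∃ C : ℝ, ∀ t : ℕ, 1 ≤ t →
      ∫ x in {x : EuclideanSpace ℝ (Fin d) | ∀ i, x i ∈ Set.Icc (-1 : ℝ) 1},
          |f t x - χ x| ^ r ≤ C * (t : ℝ) ^ (-(1 : ℝ) / 3) := by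
  set cube : Set (EuclideanSpace ℝ (Fin d)) := {x | ∀ i, x i ∈ Set.Icc (-1 : ℝ) 1} with hcube
  have hpos : ∀ t : ℕ, 0 < c ^ 3 + 3 * κ * t := fun t => by positivity
  have hmain : ∀ t : ℕ, ∫ x in cube, |f t x - χ x| ^ r ≤
      Real.sqrt d * 2 ^ (d - 1) * N * (c ^ 3 + 3 * κ * t) ^ (-(1 : ℝ) / 3) := by
    intro t
    set A : ℝ := (c ^ 3 + 3 * κ * t) ^ ((1 : ℝ) / 3) with hAdef
    have hA : 0 < A := Real.rpow_pos_of_pos (hpos t) _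
    have hAinv : (c ^ 3 + 3 * κ * t) ^ (-(1 : ℝ) / 3) = 1 / A := by
      rw [hAdef, neg_div, Real.rpow_neg (hpos t).le, one_div ((_ : ℝ) ^ _)]
    let S : ℕ → Set (EuclideanSpace ℝ (Fin d)) := fun j =>
      {x | (∀ k, x k ∈ Set.Icc (-1 : ℝ) 1) ∧
        -(1 / 2) - 1 / A ≤ ⟪τ j, x⟫ ∧ ⟪τ j, x⟫ ≤ -(1 / 2)}
    let U : Set (EuclideanSpace ℝ (Fin d)) := ⋃ j ∈ Finset.Icc 1 N, S j
    have hUm : MeasurableSet U :=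
      Finset.measurableSet_biUnion _ fun j _ => measurableSet_cube_inter_strip _ _ _
    have hUvol : volume U ≤ ENNReal.ofReal (N * (Real.sqrt d * 2 ^ (d - 1) * (1 / A))) := by
      refine (measure_biUnion_finset_le _ _).trans ?_
      refine (Finset.sum_le_sum fun j hj =>
        volume_cube_inter_unit_strip_le (hτ j hj) (-(1 / 2)) (by positivity)).trans_eq ?_
      rw [Finset.sum_const, Nat.card_Icc, Nat.add_sub_cancel, nsmul_eq_mul,
        ENNReal.ofReal_mul N.cast_nonneg, ENNReal.ofReal_natCast]
    have hUfin : volume U ≠ ⊤ := (hUvol.trans_lt ENNReal.ofReal_lt_top).ne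
    have hbound : ∀ x ∈ cube, |f t x - χ x| ^ r ≤ U.indicator (fun _ => (1 : ℝ)) x := by
      intro x hx
      by_cases hxU : x ∈ U
      · rw [Set.indicator_of_mem hxU]
        refine Real.rpow_le_one (abs_nonneg _) ?_ (by linarith)
        have hf0 : 0 ≤ f t x := by
          rw [hf]
          exact le_min zero_le_one (Finset.le_inf' _ _ fun j _ => le_max_right _ _)
        have hf1 : f t x ≤ 1 := by
          rw [hf]
          exact min_le_left _ _
        rw [hχ, abs_le]
        split_ifs <;> constructor <;> linarith
      · have heq : f t x = χ x := by
          rw [hf, hχ]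
          convert relu_min_eq_indicator (s := fun j => ⟪τ j, x⟫) (Finset.nonempty_Icc.mpr hN)
            hA (fun j hj => ha_growth j hj t)
            fun j hj hmem => hxU (Set.mem_biUnion hj ⟨hx, hmem⟩)
        rw [Set.indicator_of_notMem hxU, heq, sub_self, abs_zero,
          Real.zero_rpow (by linarith)]
    have hcm : MeasurableSet cube := by
      simp only [hcube, Set.ofPred_forall]
      exact MeasurableSet.iInter fun k => (isClosed_Icc.preimage (by fun_prop)).measurableSet
    have hint : Integrable (U.indicator fun _ => (1 : ℝ)) :=
      (integrable_indicator_iff hUm).mpr (integrableOn_const hUfin)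
    calc ∫ x in cube, |f t x - χ x| ^ r
        ≤ ∫ x in cube, U.indicator (fun _ => (1 : ℝ)) x :=
          integral_mono_of_nonneg (Filter.Eventually.of_forall fun x => by positivity)
            hint.integrableOn (ae_restrict_of_forall_mem hcm hbound)
      _ ≤ ∫ x, U.indicator (fun _ => (1 : ℝ)) x :=
          setIntegral_le_integral hint
            (Filter.Eventually.of_forall fun x => Set.indicator_nonneg (by simp) x)
      _ = volume.real U := by
          rw [integral_indicator hUm, setIntegral_const, smul_eq_mul, mul_one]
      _ ≤ N * (Real.sqrt d * 2 ^ (d - 1) * (1 / A)) :=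
          ENNReal.toReal_le_of_le_ofReal (by positivity) hUvol
      _ = Real.sqrt d * 2 ^ (d - 1) * N * (c ^ 3 + 3 * κ * t) ^ (-(1 : ℝ) / 3) := by
          rw [hAinv]
          ring
  refine ⟨hmain, Real.sqrt d * 2 ^ (d - 1) * N * (3 * κ) ^ (-(1 : ℝ) / 3), fun t ht => ?_⟩
  have htpos : (0 : ℝ) < t := by exact_mod_cast ht
  refine (hmain t).trans ?_
  rw [mul_assoc (Real.sqrt d * 2 ^ (d - 1) * N), ← Real.mul_rpow (by positivity) htpos.le]
  gcongr ?_ * ?_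
  refine Real.rpow_le_rpow_of_nonpos (by positivity) ?_ (by norm_num)
  have := pow_pos hc 3
  linarith
end
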